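/- arXiv:2405.19938 — 2 statements merged into one kernel-verified Lean document; each statement's English description precedes it below -/
import Mathlib

section
/- Let n ≥ 2 be an integer, let r ∈ {1, …, n−1}, and let C be a real symmetric n×n matrix of rank r. Let M = e^{iπ⟨CD,D⟩} be the Fourier multiplier defined on Schwartz functions by (Mu)^(ξ) = e^{iπ⟨Cξ,ξ⟩} û(ξ). Then μ(M) = (1/(4π))·Σ_{j=1}^{n} |λⱼ(C)|, where λ₁(C), …, λₙ(C) are the eigenvalues of C listed with multiplicities. -/
open MeasureTheory Matrix

noncomputable section

/-- The Fourier transform `û(ξ) = ∫ e^{-2πi x·ξ} u(x) dx`. -/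
def ft {n : ℕ} (u : (Fin n → ℝ) → ℂ) : (Fin n → ℝ) → ℂ :=
  fun ξ => ∫ x : Fin n → ℝ,
    Complex.exp (-(2 * (Real.pi : ℂ) * Complex.I) * ((x ⬝ᵥ ξ : ℝ) : ℂ)) * u x

/-- The Fourier multiplier `e^{iπ⟨CD,D⟩}`, i.e. `(Mu)^(ξ) = e^{iπ⟨Cξ,ξ⟩} û(ξ)`,
written via Fourier inversion. -/
def expCD {n : ℕ} (C : Matrix (Fin n) (Fin n) ℝ) (u : (Fin n → ℝ) → ℂ) :
    (Fin n → ℝ) → ℂ :=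
  fun x => ∫ ξ : Fin n → ℝ,
    Complex.exp (2 * (Real.pi : ℂ) * Complex.I * ((x ⬝ᵥ ξ : ℝ) : ℂ)) *
      (Complex.exp (Complex.I * (Real.pi : ℂ) * ((C.mulVec ξ ⬝ᵥ ξ : ℝ) : ℂ)) * ft u ξ)

/-- The variance `V(f) = ∫ |x|² |f(x)|² dx`. -/
def variance {n : ℕ} (f : (Fin n → ℝ) → ℂ) : ℝ :=
  ∫ x : Fin n → ℝ, (∑ i, (x i) ^ 2) * ‖f x‖ ^ 2

/-- `μ(M)`: the infimum of `√(V(Mu)·V(u))` over normalized Schwartz functions `u`. -/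
def mu {n : ℕ} (M : ((Fin n → ℝ) → ℂ) → ((Fin n → ℝ) → ℂ)) : ℝ :=
  sInf { r : ℝ | ∃ u : SchwartzMap (Fin n → ℝ) ℂ,
    (∫ x, ‖u x‖ ^ 2) = 1 ∧ r = Real.sqrt (variance (M ⇑u) * variance ⇑u) }

section Schwartz

open scoped SchwartzMap FourierTransform LineDeriv ContDiff Nat
open SchwartzMap

lemma iteratedDeriv_cexp_mul_ofReal (z : ℂ) (n : ℕ) :
    iteratedDeriv n (fun t : ℝ => Complex.exp (z * t)) =
      fun t : ℝ => z ^ n * Complex.exp (z * t) := by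
  induction n with
  | zero => simp
  | succ n ih =>
    rw [iteratedDeriv_succ, ih]
    funext t
    have h : HasDerivAt (fun t : ℝ => Complex.exp (z * t)) (Complex.exp (z * t) * (z * 1)) t :=
      ((Complex.ofRealCLM.hasDerivAt (x := t)).const_mul z).cexp
    rw [(h.const_mul (z ^ n)).deriv]
    ring

lemma norm_iteratedFDeriv_cexp_mul_ofReal (z : ℂ) (n : ℕ) (t : ℝ) :
    ‖iteratedFDeriv ℝ n (fun t : ℝ => Complex.exp (z * t)) t‖ =
      ‖z‖ ^ n * Real.exp (z.re * t) := by
  rw [norm_iteratedFDeriv_eq_norm_iteratedDeriv, iteratedDeriv_cexp_mul_ofReal, norm_mul, norm_pow,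
    Complex.norm_exp, Complex.re_mul_ofReal]

lemma contDiff_cexp_mul_ofReal (z : ℂ) {N : ℕ∞ω} :
    ContDiff ℝ N (fun t : ℝ => Complex.exp (z * t)) :=
  (contDiff_const.mul Complex.ofRealCLM.contDiff).cexp

lemma hasTemperateGrowth_cexp_I_mul {E : Type*} [NormedAddCommGroup E] [NormedSpace ℝ E]
    {q : E → ℝ} (hq : q.HasTemperateGrowth) :
    Function.HasTemperateGrowth (fun x => Complex.exp (Complex.I * q x)) := by
  have h : Function.HasTemperateGrowth (fun t : ℝ => Complex.exp (Complex.I * t)) :=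
    ⟨contDiff_cexp_mul_ofReal _, fun n => ⟨0, 1, fun t => by
      rw [norm_iteratedFDeriv_cexp_mul_ofReal]; simp⟩⟩
  exact h.comp hq

/-- `exp (-q)` is a Schwartz function if `q` is smooth of temperate growth and grows at least
quadratically. -/
lemma exists_schwartzMap_cexp_neg {E : Type*} [NormedAddCommGroup E] [NormedSpace ℝ E]
    {q : E → ℝ} (hq : q.HasTemperateGrowth) {c : ℝ} (hc : 0 < c) (hqc : ∀ x, c * ‖x‖ ^ 2 ≤ q x) :
    ∃ g : 𝓢(E, ℂ), ∀ x, g x = Complex.exp (-(q x : ℂ)) := by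
  have hcomp : (fun x => Complex.exp (-(q x : ℂ))) =
      (fun t : ℝ => Complex.exp ((-1 : ℂ) * t)) ∘ q := by
    funext x; simp
  refine ⟨⟨fun x => Complex.exp (-(q x : ℂ)), ?_, ?_⟩, fun x => rfl⟩
  · rw [hcomp]; exact (contDiff_cexp_mul_ofReal _).comp hq.1
  · intro k n
    obtain ⟨l, C, hC, hbound⟩ := hq.norm_iteratedFDeriv_le_uniform n
    obtain ⟨B, hB⟩ : ∃ B : ℝ, ∀ r : ℝ, 0 ≤ r →
        (1 + r) ^ (k + l * n) * Real.exp (-(c * r ^ 2)) ≤ B := by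
      set m := k + l * n
      -- `(1+r)^m ≤ m! exp (1+r)` and `1 + r - c r² ` is bounded above
      refine ⟨m ! * Real.exp (1 + 1 / (4 * c)), fun r hr => ?_⟩
      have h1 : (1 + r) ^ m ≤ m ! * Real.exp (1 + r) := by
        have := Real.pow_div_factorial_le_exp (1 + r) (by positivity) m
        rwa [div_le_iff₀' (by positivity)] at this
      calc (1 + r) ^ m * Real.exp (-(c * r ^ 2))
          ≤ m ! * Real.exp (1 + r) * Real.exp (-(c * r ^ 2)) := by gcongr
        _ = m ! * Real.exp (1 + r + -(c * r ^ 2)) := by rw [mul_assoc, ← Real.exp_add]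
        _ ≤ _ := by
          gcongr ?_ * Real.exp ?_
          have h : 1 / (4 * c) - r + c * r ^ 2 = c * (r - 1 / (2 * c)) ^ 2 := by
            field_simp; ring
          nlinarith [mul_nonneg hc.le (sq_nonneg (r - 1 / (2 * c)))]
    refine ⟨n ! * (1 + C) ^ n * B, fun x => ?_⟩
    have hx : (1 : ℝ) ≤ 1 + ‖x‖ := by simp
    have key := norm_iteratedFDeriv_comp_le (n := n) (N := ∞) (contDiff_cexp_mul_ofReal (-1)) hq.1
      (mod_cast le_top) x (C := Real.exp (-(c * ‖x‖ ^ 2))) (D := (1 + C) * (1 + ‖x‖) ^ l)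
      (fun i _ => by
        rw [norm_iteratedFDeriv_cexp_mul_ofReal]
        simpa using hqc x)
      (fun i hi hin => by
        have h1 : (1 : ℝ) ≤ (1 + C) * (1 + ‖x‖) ^ l := by
          have := one_le_pow₀ hx (n := l)
          nlinarith
        refine (hbound i hin x).trans (le_trans ?_ (le_self_pow₀ h1 (by omega)))
        gcongr
        linarith)
    change ‖x‖ ^ k * ‖iteratedFDeriv ℝ n (fun x => Complex.exp (-(q x : ℂ))) x‖ ≤ _
    rw [hcomp]
    calc _ ≤ (1 + ‖x‖) ^ k * (n ! * Real.exp (-(c * ‖x‖ ^ 2)) * ((1 + C) * (1 + ‖x‖) ^ l) ^ n) := by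
          gcongr
          linarith
      _ = n ! * (1 + C) ^ n * ((1 + ‖x‖) ^ (k + l * n) * Real.exp (-(c * ‖x‖ ^ 2))) := by
          rw [mul_pow, ← pow_mul, pow_add]; ring
      _ ≤ _ := by
          gcongr
          exact hB _ (norm_nonneg x)

variable {n : ℕ}

/-- Multiplication of a Schwartz function by the `j`-th coordinate. -/
def coordMul (j : Fin n) (g : 𝓢(EuclideanSpace ℝ (Fin n), ℂ)) :
    𝓢(EuclideanSpace ℝ (Fin n), ℂ) :=
  smulLeftCLM ℂ (fun x => inner ℝ x (EuclideanSpace.single j (1 : ℝ))) g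

@[simp] lemma coordMul_apply (j : Fin n) (g : 𝓢(EuclideanSpace ℝ (Fin n), ℂ))
    (x : EuclideanSpace ℝ (Fin n)) : coordMul j g x = x j * g x := by
  rw [coordMul, smulLeftCLM_apply_apply (by fun_prop)]
  simp [EuclideanSpace.inner_single_right]

/-- The `j`-th partial derivative of a Schwartz function. -/
def partialDeriv (j : Fin n) (g : 𝓢(EuclideanSpace ℝ (Fin n), ℂ)) :
    𝓢(EuclideanSpace ℝ (Fin n), ℂ) :=
  ∂_{EuclideanSpace.single j (1 : ℝ)} g

lemma partialDeriv_apply (j : Fin n) (g : 𝓢(EuclideanSpace ℝ (Fin n), ℂ))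
    (x : EuclideanSpace ℝ (Fin n)) :
    partialDeriv j g x = fderiv ℝ g x (EuclideanSpace.single j 1) := rfl

lemma partialDeriv_coordMul (j : Fin n) (g : 𝓢(EuclideanSpace ℝ (Fin n), ℂ)) :
    partialDeriv j (coordMul j g) = g + coordMul j (partialDeriv j g) := by
  ext x
  have hco : HasFDerivAt (fun y : EuclideanSpace ℝ (Fin n) => ((y j : ℝ) : ℂ))
      (Complex.ofRealCLM ∘L (EuclideanSpace.proj j)) x :=
    (Complex.ofRealCLM ∘L (EuclideanSpace.proj (𝕜 := ℝ) j)).hasFDerivAt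
  have h : ⇑(coordMul j g) = fun y => ((y j : ℝ) : ℂ) * g y :=
    funext fun y => coordMul_apply j g y
  rw [partialDeriv_apply, h, (hco.fun_mul (g.hasFDerivAt x)).fderiv]
  simp [partialDeriv_apply]
  ring

lemma integrable_norm_sq (g : 𝓢(EuclideanSpace ℝ (Fin n), ℂ)) :
    Integrable fun x => ‖g x‖ ^ 2 :=
  (g.memLp 2).integrable_norm_pow (by simp)

lemma integrable_inner (f g : 𝓢(EuclideanSpace ℝ (Fin n), ℂ)) :
    Integrable fun x => inner ℝ (f x) (g x) :=
  (bilinLeftCLM (innerSL ℝ) g.hasTemperateGrowth f).integrable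

lemma integral_inner_coordMul_partialDeriv (j : Fin n) (g : 𝓢(EuclideanSpace ℝ (Fin n), ℂ)) :
    ∫ x, inner ℝ (coordMul j g x) (partialDeriv j g x) = -(1 / 2) * ∫ x, ‖g x‖ ^ 2 := by
  have h := integral_bilinear_lineDerivOp_right_eq_neg_left (μ := volume) (coordMul j g) g
    (innerSL ℝ) (EuclideanSpace.single j 1)
  change ∫ x, inner ℝ (coordMul j g x) (partialDeriv j g x) =
    -∫ x, inner ℝ (partialDeriv j (coordMul j g) x) (g x) at h
  have h2 : ∀ x, inner ℝ (partialDeriv j (coordMul j g) x) (g x) =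
      ‖g x‖ ^ 2 + inner ℝ (coordMul j g x) (partialDeriv j g x) := by
    intro x
    rw [partialDeriv_coordMul, _root_.add_apply, inner_add_left, real_inner_self_eq_norm_sq]
    simp [Complex.inner]
    ring
  simp_rw [h2] at h
  rw [integral_add (integrable_norm_sq g) (integrable_inner _ _)] at h
  linarith

/-- Cauchy-Schwarz inequality for Schwartz functions. -/
lemma abs_integral_inner_le (f g : 𝓢(EuclideanSpace ℝ (Fin n), ℂ)) :
    |∫ x, inner ℝ (f x) (g x)| ≤ √(∫ x, ‖f x‖ ^ 2) * √(∫ x, ‖g x‖ ^ 2) := by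
  have hint : Integrable fun x => ‖f x‖ * ‖g x‖ := (f.memLp 2).norm.integrable_mul (g.memLp 2).norm
  rw [← Real.norm_eq_abs]
  calc ‖∫ x, inner ℝ (f x) (g x)‖ ≤ ∫ x, ‖f x‖ * ‖g x‖ :=
        norm_integral_le_of_norm_le hint (.of_forall fun x => norm_inner_le_norm _ _)
    _ ≤ _ := by
      have h := integral_mul_norm_le_Lp_mul_Lq (μ := volume) (f := f) (g := g)
        Real.HolderConjugate.two_two (by simpa using f.memLp 2) (by simpa using g.memLp 2)
      simpa [Real.sqrt_eq_rpow] using h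

/-- The derivative `∂ⱼ` conjugated by the chirp `exp(iπ Σ λⱼ xⱼ²)`. -/
def twistedDeriv (lam : Fin n → ℝ) (j : Fin n) (g : 𝓢(EuclideanSpace ℝ (Fin n), ℂ)) :
    𝓢(EuclideanSpace ℝ (Fin n), ℂ) :=
  partialDeriv j g + (2 * Real.pi * Complex.I * lam j : ℂ) • coordMul j g

lemma twistedDeriv_apply (lam : Fin n → ℝ) (j : Fin n) (g : 𝓢(EuclideanSpace ℝ (Fin n), ℂ))
    (x : EuclideanSpace ℝ (Fin n)) : twistedDeriv lam j g x =
      partialDeriv j g x + 2 * Real.pi * Complex.I * lam j * (x j * g x) := by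
  simp [twistedDeriv]

lemma uncertainty_twistedDeriv (lam : Fin n → ℝ) (j : Fin n)
    (g : 𝓢(EuclideanSpace ℝ (Fin n), ℂ)) :
    Real.pi * |lam j| * ∫ x, ‖g x‖ ^ 2 ≤
      √(∫ x, ‖partialDeriv j g x‖ ^ 2) * √(∫ x, ‖twistedDeriv lam j g x‖ ^ 2) := by
  have h := abs_integral_inner_le (Complex.I • partialDeriv j g) (twistedDeriv lam j g)
  have h1 : ∀ x, inner ℝ ((Complex.I • partialDeriv j g) x) (twistedDeriv lam j g x) =
      2 * Real.pi * lam j * inner ℝ (coordMul j g x) (partialDeriv j g x) := by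
    intro x
    rw [twistedDeriv_apply]
    simp [Complex.inner]
    ring
  have h2 : ∀ x, ‖(Complex.I • partialDeriv j g) x‖ = ‖partialDeriv j g x‖ := by
    intro x; simp
  simp_rw [h1, h2] at h
  rw [integral_const_mul, integral_inner_coordMul_partialDeriv] at h
  refine le_trans (le_of_eq ?_) h
  have : 2 * Real.pi * lam j * (-(1 / 2) * ∫ x, ‖g x‖ ^ 2) =
    -(Real.pi * lam j * ∫ x, ‖g x‖ ^ 2) := by ring
  rw [this, abs_neg, abs_mul, abs_mul, abs_of_pos Real.pi_pos,
    abs_of_nonneg (integral_nonneg fun x => by positivity)]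

lemma uncertainty_sum (lam : Fin n → ℝ) (g : 𝓢(EuclideanSpace ℝ (Fin n), ℂ)) :
    Real.pi * (∑ j, |lam j|) * ∫ x, ‖g x‖ ^ 2 ≤
      √((∑ j, ∫ x, ‖twistedDeriv lam j g x‖ ^ 2) * ∑ j, ∫ x, ‖partialDeriv j g x‖ ^ 2) := by
  have hnn : ∀ f : 𝓢(EuclideanSpace ℝ (Fin n), ℂ), 0 ≤ ∫ x, ‖f x‖ ^ 2 :=
    fun f => integral_nonneg fun x => by positivity
  calc Real.pi * (∑ j, |lam j|) * ∫ x, ‖g x‖ ^ 2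
      = ∑ j, Real.pi * |lam j| * ∫ x, ‖g x‖ ^ 2 := by
        rw [Finset.mul_sum, Finset.sum_mul]
    _ ≤ ∑ j, √(∫ x, ‖partialDeriv j g x‖ ^ 2) * √(∫ x, ‖twistedDeriv lam j g x‖ ^ 2) :=
        Finset.sum_le_sum fun j _ => uncertainty_twistedDeriv lam j g
    _ ≤ _ := Real.sum_sqrt_mul_sqrt_le _ (fun _ => hnn _) (fun _ => hnn _)
    _ = _ := by
        rw [mul_comm, Real.sqrt_mul (Finset.sum_nonneg fun _ _ => hnn _)]

lemma integral_norm_sq_mul_eq (w : 𝓢(EuclideanSpace ℝ (Fin n), ℂ)) :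
    ∫ x, ‖x‖ ^ 2 * ‖w x‖ ^ 2 =
      1 / (4 * Real.pi ^ 2) * ∑ j, ∫ ξ, ‖partialDeriv j (𝓕 w) ξ‖ ^ 2 := by
  have h1 : ∀ j, ∫ ξ, ‖partialDeriv j (𝓕 w) ξ‖ ^ 2 =
      4 * Real.pi ^ 2 * ∫ x, ‖coordMul j w x‖ ^ 2 := by
    intro j
    rw [partialDeriv, lineDerivOp_fourier_eq, integral_norm_sq_fourier, ← integral_const_mul]
    refine integral_congr_ae (.of_forall fun x => ?_)
    change ‖(-(2 * Real.pi * Complex.I) • coordMul j w) x‖ ^ 2 = _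
    rw [_root_.smul_apply, norm_smul, mul_pow]
    congr 1
    simp [abs_of_pos Real.pi_pos]
    ring
  simp_rw [h1]
  rw [← Finset.mul_sum, ← integral_finsetSum _ fun j _ => integrable_norm_sq _, ← mul_assoc,
    one_div_mul_cancel (by positivity), one_mul]
  refine integral_congr_ae (.of_forall fun x => ?_)
  simp only [coordMul_apply, norm_mul, mul_pow, ← Finset.sum_mul, EuclideanSpace.norm_sq_eq,
    Complex.norm_real]

/-- The quadratic form `π Σ aⱼ xⱼ²`. -/
def diagForm (a : Fin n → ℝ) (x : EuclideanSpace ℝ (Fin n)) : ℝ :=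
  Real.pi * ∑ j, a j * x j ^ 2

lemma hasFDerivAt_diagForm (a : Fin n → ℝ) (x : EuclideanSpace ℝ (Fin n)) :
    HasFDerivAt (diagForm a)
      (Real.pi • ∑ j, a j • (2 * x j) • (EuclideanSpace.proj (𝕜 := ℝ) j :
        EuclideanSpace ℝ (Fin n) →L[ℝ] ℝ)) x := by
  refine HasFDerivAt.const_mul (HasFDerivAt.fun_sum fun j _ => HasFDerivAt.const_mul ?_ _) _
  have := ((EuclideanSpace.proj (𝕜 := ℝ) j :
        EuclideanSpace ℝ (Fin n) →L[ℝ] ℝ).hasFDerivAt (x := x)).pow 2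
  simpa using this

lemma hasTemperateGrowth_diagForm (a : Fin n → ℝ) : (diagForm a).HasTemperateGrowth := by
  have h : ∀ j : Fin n, Function.HasTemperateGrowth (fun x : EuclideanSpace ℝ (Fin n) => x j) :=
    fun j => (EuclideanSpace.proj (𝕜 := ℝ) j :
        EuclideanSpace ℝ (Fin n) →L[ℝ] ℝ).hasTemperateGrowth
  exact (Function.HasTemperateGrowth.const _).mul
    (Function.HasTemperateGrowth.sum fun j _ => (Function.HasTemperateGrowth.const _).mul
      ((h j).pow 2))

/-- Derivative of `exp(z q)` for a real diagonal quadratic form `q`. -/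
lemma hasFDerivAt_cexp_diagForm (a : Fin n → ℝ) (z : ℂ) (x : EuclideanSpace ℝ (Fin n)) :
    ∃ L : EuclideanSpace ℝ (Fin n) →L[ℝ] ℂ,
      HasFDerivAt (fun y => Complex.exp (z * diagForm a y)) L x ∧
      ∀ j, L (EuclideanSpace.single j 1) =
        2 * Real.pi * z * a j * x j * Complex.exp (z * diagForm a x) := by
  have h1 := (Complex.ofRealCLM.hasFDerivAt.comp x (hasFDerivAt_diagForm a x)).const_mul z
  refine ⟨_, h1.cexp, fun j => ?_⟩
  simp
  ring

/-- The chirp `exp(iπ Σ λⱼ ξⱼ²)`. -/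
def chirp (lam : Fin n → ℝ) (x : EuclideanSpace ℝ (Fin n)) : ℂ :=
  Complex.exp (Complex.I * diagForm lam x)

lemma hasTemperateGrowth_chirp (lam : Fin n → ℝ) : (chirp lam).HasTemperateGrowth :=
  hasTemperateGrowth_cexp_I_mul (hasTemperateGrowth_diagForm lam)

@[simp] lemma norm_chirp (lam : Fin n → ℝ) (x : EuclideanSpace ℝ (Fin n)) :
    ‖chirp lam x‖ = 1 := by
  simp [chirp, Complex.norm_exp]

lemma partialDeriv_chirp_smul (lam : Fin n → ℝ) (j : Fin n)
    (g : 𝓢(EuclideanSpace ℝ (Fin n), ℂ)) (x : EuclideanSpace ℝ (Fin n)) :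
    partialDeriv j (smulLeftCLM ℂ (chirp lam) g) x = chirp lam x * twistedDeriv lam j g x := by
  obtain ⟨L, hL, hLj⟩ := hasFDerivAt_cexp_diagForm lam Complex.I x
  have h : ⇑(smulLeftCLM ℂ (chirp lam) g) =
      fun y => Complex.exp (Complex.I * diagForm lam y) * g y :=
    funext fun y => by
      rw [smulLeftCLM_apply_apply (hasTemperateGrowth_chirp lam), smul_eq_mul, chirp]
  rw [partialDeriv_apply, h, (hL.fun_mul (g.hasFDerivAt x)).fderiv, twistedDeriv_apply]
  simp [partialDeriv_apply, hLj, chirp]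
  ring

/-- Gaussians almost attaining the uncertainty inequality. -/
lemma exists_gaussian (lam : Fin n → ℝ) {δ : ℝ} (hδ : 0 < δ) :
    ∃ g : 𝓢(EuclideanSpace ℝ (Fin n), ℂ), ∫ x, ‖g x‖ ^ 2 = 1 ∧ ∀ j,
      ∫ x, ‖twistedDeriv lam j g x‖ ^ 2 = ∫ x, ‖partialDeriv j g x‖ ^ 2 ∧
      ∫ x, ‖partialDeriv j g x‖ ^ 2 ≤ Real.pi * (|lam j| + δ) := by
  set a : Fin n → ℝ := fun j => |lam j| / 2 + δ with ha
  have ha_pos : ∀ j, 0 < a j := fun j => by positivity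
  obtain ⟨g₀, hg₀⟩ := exists_schwartzMap_cexp_neg (hasTemperateGrowth_diagForm a)
    (c := Real.pi * δ) (by positivity) (fun x => by
      rw [diagForm, EuclideanSpace.norm_sq_eq, mul_assoc, Finset.mul_sum]
      simp only [Real.norm_eq_abs, sq_abs]
      gcongr with j
      simp only [ha]
      linarith [abs_nonneg (lam j)])
  set b : Fin n → ℝ := fun j => -(lam j / 2) with hb
  set g₁ := smulLeftCLM ℂ (chirp b) g₀ with hg₁
  have hg₁x : ∀ x, g₁ x = chirp b x * g₀ x := fun x => by
    rw [hg₁, smulLeftCLM_apply_apply (hasTemperateGrowth_chirp b), smul_eq_mul]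
  have hpos : 0 < ∫ x, ‖g₁ x‖ ^ 2 := by
    refine (integral_pos_iff_support_of_nonneg (fun x => by positivity)
      (integrable_norm_sq g₁)).2 ?_
    have : Function.support (fun x => ‖g₁ x‖ ^ 2) = Set.univ := by
      ext x
      simp [hg₁x, hg₀, chirp]
    rw [this]
    exact Measure.measure_univ_pos.2 (NeZero.ne _)
  set s : ℝ := (√(∫ x, ‖g₁ x‖ ^ 2))⁻¹ with hs
  set g := (s : ℂ) • g₁ with hg
  have hnorm : ∫ x, ‖g x‖ ^ 2 = 1 := by
    have : ∀ x, ‖g x‖ ^ 2 = s ^ 2 * ‖g₁ x‖ ^ 2 := fun x => by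
      simp [hg, mul_pow]
    simp_rw [this]
    rw [integral_const_mul, hs, inv_pow, Real.sq_sqrt hpos.le, inv_mul_cancel₀ hpos.ne']
  have hD : ∀ j x, partialDeriv j g x =
      (-2 * Real.pi * (a j + Complex.I * (lam j / 2)) : ℂ) * coordMul j g x := by
    intro j x
    obtain ⟨L₁, hL₁, hL₁j⟩ := hasFDerivAt_cexp_diagForm a (-1) x
    obtain ⟨L₂, hL₂, hL₂j⟩ := hasFDerivAt_cexp_diagForm b Complex.I x
    have h : ⇑g = fun y => (s : ℂ) *
        (Complex.exp (Complex.I * diagForm b y) * Complex.exp ((-1 : ℂ) * diagForm a y)) :=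
      funext fun y => by
        simp [hg, hg₁x, hg₀, chirp]
    rw [partialDeriv_apply, h, ((hL₂.fun_mul hL₁).const_mul (s : ℂ)).fderiv]
    simp [hL₁j, hL₂j, hg, hg₁x, hg₀, chirp, hb]
    ring
  have hX : ∀ j, ∫ x, ‖coordMul j g x‖ ^ 2 = 1 / (4 * Real.pi * a j) := by
    intro j
    have h := integral_inner_coordMul_partialDeriv j g
    have h2 : ∀ x, inner ℝ (coordMul j g x) (partialDeriv j g x) =
        (-2 * Real.pi * a j) * ‖coordMul j g x‖ ^ 2 := by
      intro x
      rw [hD, ← Complex.normSq_eq_norm_sq, Complex.normSq_apply]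
      generalize coordMul j g x = w
      simp [Complex.inner]
      ring
    simp_rw [h2] at h
    rw [integral_const_mul, hnorm] at h
    have := ha_pos j
    field_simp
    linarith
  have hT : ∀ j x, twistedDeriv lam j g x =
      (-2 * Real.pi * (a j - Complex.I * (lam j / 2)) : ℂ) * coordMul j g x := by
    intro j x
    rw [twistedDeriv_apply, hD, coordMul_apply]
    ring
  have hDn : ∀ j x, ‖partialDeriv j g x‖ ^ 2 =
      4 * Real.pi ^ 2 * (a j ^ 2 + (lam j / 2) ^ 2) * ‖coordMul j g x‖ ^ 2 := by
    intro j x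
    rw [hD, norm_mul, mul_pow, ← Complex.normSq_eq_norm_sq, Complex.normSq_apply]
    congr 1
    simp
    ring
  have hTn : ∀ j x, ‖twistedDeriv lam j g x‖ ^ 2 =
      4 * Real.pi ^ 2 * (a j ^ 2 + (lam j / 2) ^ 2) * ‖coordMul j g x‖ ^ 2 := by
    intro j x
    rw [hT, norm_mul, mul_pow, ← Complex.normSq_eq_norm_sq, Complex.normSq_apply]
    congr 1
    simp
    ring
  refine ⟨g, hnorm, fun j => ⟨by simp_rw [hDn, hTn], ?_⟩⟩
  simp_rw [hDn]
  rw [integral_const_mul, hX]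
  have h1 := ha_pos j
  have h2 : a j ^ 2 + (lam j / 2) ^ 2 ≤ a j * (|lam j| + δ) := by
    simp only [ha]
    nlinarith [abs_nonneg (lam j), sq_abs (lam j)]
  calc _ = Real.pi * ((a j ^ 2 + (lam j / 2) ^ 2) / a j) := by field_simp
    _ ≤ _ := by
      gcongr
      rw [div_le_iff₀' h1]
      exact h2

end Schwartz

section Rotation

open scoped SchwartzMap FourierTransform
open SchwartzMap

variable {n : ℕ}

/-- The isometry from Euclidean space to `Fin n → ℝ` sending the standard basis to `b`. -/
def basisRotation (b : OrthonormalBasis (Fin n) ℝ (EuclideanSpace ℝ (Fin n))) :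
    EuclideanSpace ℝ (Fin n) ≃L[ℝ] (Fin n → ℝ) :=
  b.repr.symm.toContinuousLinearEquiv.trans (EuclideanSpace.equiv (Fin n) ℝ)

variable (b : OrthonormalBasis (Fin n) ℝ (EuclideanSpace ℝ (Fin n)))

lemma basisRotation_apply (x : EuclideanSpace ℝ (Fin n)) :
    basisRotation b x = WithLp.ofLp (b.repr.symm x) := rfl

lemma measurePreserving_rotation : MeasurePreserving (basisRotation b) volume volume :=
  (PiLp.volume_preserving_ofLp (Fin n)).comp b.measurePreserving_repr_symm

lemma integral_comp_rotation {F : Type*} [NormedAddCommGroup F] [NormedSpace ℝ F]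
    (f : (Fin n → ℝ) → F) : ∫ x, f (basisRotation b x) = ∫ x, f x :=
  (measurePreserving_rotation b).integral_comp
    (basisRotation b).toHomeomorph.measurableEmbedding f

lemma rotation_dotProduct (x y : EuclideanSpace ℝ (Fin n)) :
    basisRotation b x ⬝ᵥ basisRotation b y = inner ℝ x y := by
  rw [← b.repr.symm.inner_map_map x y, EuclideanSpace.inner_eq_star_dotProduct, dotProduct_comm]
  simp [basisRotation_apply]

lemma variance_eq_integral_rotation (f : (Fin n → ℝ) → ℂ) :
    variance f = ∫ x : EuclideanSpace ℝ (Fin n), ‖x‖ ^ 2 * ‖f (basisRotation b x)‖ ^ 2 := by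
  rw [variance, ← integral_comp_rotation b]
  refine integral_congr_ae (.of_forall fun x => ?_)
  have h := rotation_dotProduct b x x
  rw [real_inner_self_eq_norm_sq] at h
  simp only [← h, dotProduct, sq]

lemma ft_rotation (u : 𝓢(Fin n → ℝ, ℂ)) (ξ : EuclideanSpace ℝ (Fin n)) :
    ft u (basisRotation b ξ) = 𝓕 (compCLMOfContinuousLinearEquiv ℂ (basisRotation b) u) ξ := by
  rw [ft, ← integral_comp_rotation b, fourier_coe, Real.fourier_eq']
  refine integral_congr_ae (.of_forall fun x => ?_)
  simp only [rotation_dotProduct, smul_eq_mul, compCLMOfContinuousLinearEquiv_apply,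
    Function.comp_apply]
  congr 2
  push_cast
  ring

lemma expCD_rotation {C : Matrix (Fin n) (Fin n) ℝ} {lam : Fin n → ℝ}
    (hC : ∀ x, C.mulVec (basisRotation b x) ⬝ᵥ basisRotation b x = ∑ j, lam j * x j ^ 2)
    (u : 𝓢(Fin n → ℝ, ℂ)) (x : EuclideanSpace ℝ (Fin n)) :
    expCD C u (basisRotation b x) =
      𝓕⁻ (smulLeftCLM ℂ (chirp lam)
        (𝓕 (compCLMOfContinuousLinearEquiv ℂ (basisRotation b) u))) x := by
  rw [expCD, ← integral_comp_rotation b, fourierInv_coe, Real.fourierInv_eq']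
  refine integral_congr_ae (.of_forall fun ξ => ?_)
  simp only [rotation_dotProduct, smul_eq_mul, ft_rotation, hC,
    smulLeftCLM_apply_apply (hasTemperateGrowth_chirp lam), chirp, diagForm]
  rw [real_inner_comm]
  congr 2
  · push_cast
    ring_nf
  · push_cast
    ring_nf

lemma variance_schwartz (u : 𝓢(Fin n → ℝ, ℂ)) :
    variance u = 1 / (4 * Real.pi ^ 2) * ∑ j, ∫ ξ,
      ‖partialDeriv j (𝓕 (compCLMOfContinuousLinearEquiv ℂ (basisRotation b) u)) ξ‖ ^ 2 := by
  rw [variance_eq_integral_rotation b, ← integral_norm_sq_mul_eq]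
  rfl

lemma variance_expCD {C : Matrix (Fin n) (Fin n) ℝ} {lam : Fin n → ℝ}
    (hC : ∀ x, C.mulVec (basisRotation b x) ⬝ᵥ basisRotation b x = ∑ j, lam j * x j ^ 2)
    (u : 𝓢(Fin n → ℝ, ℂ)) :
    variance (expCD C u) = 1 / (4 * Real.pi ^ 2) * ∑ j, ∫ ξ,
      ‖twistedDeriv lam j (𝓕 (compCLMOfContinuousLinearEquiv ℂ (basisRotation b) u)) ξ‖ ^ 2 := by
  simp_rw [variance_eq_integral_rotation b, expCD_rotation b hC]
  rw [integral_norm_sq_mul_eq]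
  simp_rw [FourierTransform.fourier_fourierInv_eq, partialDeriv_chirp_smul, norm_mul, norm_chirp,
    one_mul]

lemma integral_norm_sq_fourier_rotation (u : 𝓢(Fin n → ℝ, ℂ)) :
    ∫ ξ, ‖𝓕 (compCLMOfContinuousLinearEquiv ℂ (basisRotation b) u) ξ‖ ^ 2 = ∫ x, ‖u x‖ ^ 2 := by
  rw [integral_norm_sq_fourier, ← integral_comp_rotation b]
  rfl

lemma mulVec_rotation_eigenvectorBasis {C : Matrix (Fin n) (Fin n) ℝ} (hC : C.IsHermitian)
    (x : EuclideanSpace ℝ (Fin n)) :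
    C.mulVec (basisRotation hC.eigenvectorBasis x) ⬝ᵥ basisRotation hC.eigenvectorBasis x =
      ∑ j, hC.eigenvalues j * x j ^ 2 := by
  have h : C.mulVec (basisRotation hC.eigenvectorBasis x) = basisRotation hC.eigenvectorBasis
      (WithLp.toLp 2 fun j => hC.eigenvalues j * x j) := by
    simp only [basisRotation_apply, ← OrthonormalBasis.sum_repr_symm, WithLp.ofLp_sum,
      WithLp.ofLp_smul, mulVec_sum, mulVec_smul, hC.mulVec_eigenvectorBasis, smul_smul, mul_comm]
  rw [h, rotation_dotProduct]
  simp only [PiLp.inner_apply, RCLike.inner_apply, conj_trivial]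
  exact Finset.sum_congr rfl fun j _ => by ring

end Rotation

open scoped SchwartzMap FourierTransform in
/-- The value of `mu` after diagonalizing the quadratic form of `C`. -/
lemma mu_expCD_of_rotation {n : ℕ} (b : OrthonormalBasis (Fin n) ℝ (EuclideanSpace ℝ (Fin n)))
    {C : Matrix (Fin n) (Fin n) ℝ} {lam : Fin n → ℝ}
    (hC : ∀ x, C.mulVec (basisRotation b x) ⬝ᵥ basisRotation b x = ∑ j, lam j * x j ^ 2) :
    mu (expCD C) = 1 / (4 * Real.pi) * ∑ j, |lam j| := by
  have hlower : ∀ r ∈ { r : ℝ | ∃ u : SchwartzMap (Fin n → ℝ) ℂ,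
      (∫ x, ‖u x‖ ^ 2) = 1 ∧ r = √(variance (expCD C u) * variance u) },
      1 / (4 * Real.pi) * ∑ j, |lam j| ≤ r := by
    rintro r ⟨u, hu, rfl⟩
    have h := uncertainty_sum lam
      (𝓕 (SchwartzMap.compCLMOfContinuousLinearEquiv ℂ (basisRotation b) u))
    rw [integral_norm_sq_fourier_rotation, hu, mul_one] at h
    rw [variance_expCD b hC, variance_schwartz b, mul_mul_mul_comm,
      Real.sqrt_mul (by positivity), Real.sqrt_mul_self (by positivity)]
    calc 1 / (4 * Real.pi) * ∑ j, |lam j|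
        = 1 / (4 * Real.pi ^ 2) * (Real.pi * ∑ j, |lam j|) := by field_simp
      _ ≤ _ := by gcongr
  have hupper : ∀ δ : ℝ, 0 < δ → ∃ r ∈ { r : ℝ | ∃ u : SchwartzMap (Fin n → ℝ) ℂ,
      (∫ x, ‖u x‖ ^ 2) = 1 ∧ r = √(variance (expCD C u) * variance u) },
      r ≤ 1 / (4 * Real.pi) * ∑ j, (|lam j| + δ) := by
    intro δ hδ
    obtain ⟨g, hg, hgj⟩ := exists_gaussian lam hδ
    set u := SchwartzMap.compCLMOfContinuousLinearEquiv ℂ (basisRotation b).symm (𝓕⁻ g) with hu_def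
    have hu : 𝓕 (SchwartzMap.compCLMOfContinuousLinearEquiv ℂ (basisRotation b) u) = g := by
      have : SchwartzMap.compCLMOfContinuousLinearEquiv ℂ (basisRotation b) u = 𝓕⁻ g := by
        ext x
        simp [hu_def]
      rw [this, FourierTransform.fourier_fourierInv_eq]
    have hV : variance (expCD C u) = variance u := by
      rw [variance_expCD b hC, variance_schwartz b, hu]
      simp_rw [fun j => (hgj j).1]
    refine ⟨_, ⟨u, ?_, rfl⟩, ?_⟩
    · rw [← integral_norm_sq_fourier_rotation b, hu, hg]
    · have hnn : 0 ≤ variance u := integral_nonneg fun x => by positivity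
      rw [hV, Real.sqrt_mul_self hnn, variance_schwartz b, hu]
      calc _ ≤ 1 / (4 * Real.pi ^ 2) * ∑ j, Real.pi * (|lam j| + δ) := by
            gcongr with j
            exact (hgj j).2
        _ = _ := by
            rw [← Finset.mul_sum]
            field_simp
  refine le_antisymm (le_of_forall_pos_le_add fun ε hε => ?_) ?_
  · set δ := 4 * Real.pi * ε / (n + 1) with hδ_def
    have hδ : 0 < δ := by positivity
    obtain ⟨r, hr, hle⟩ := hupper δ hδ
    refine (csInf_le ⟨_, fun r hr => hlower r hr⟩ hr).trans (hle.trans ?_)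
    rw [Finset.sum_add_distrib, mul_add]
    gcongr
    rw [Finset.sum_const, Finset.card_univ, Fintype.card_fin, nsmul_eq_mul, hδ_def]
    have h : 1 / (4 * Real.pi) * (n * (4 * Real.pi * ε / (n + 1))) = ε * (n / (n + 1)) := by
      field_simp
    rw [h]
    exact mul_le_of_le_one_right hε.le ((div_le_one (by positivity)).2 (by linarith))
  · obtain ⟨r, hr, -⟩ := hupper 1 one_pos
    exact le_csInf ⟨r, hr⟩ hlower

theorem mu_expCD_eq {n : ℕ} (hn : 2 ≤ n) (r : ℕ) (hr1 : 1 ≤ r) (hr2 : r ≤ n - 1)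
    (C : Matrix (Fin n) (Fin n) ℝ) (hC : C.IsSymm) (hrank : C.rank = r) :
    mu (expCD C) =
      (1 / (4 * Real.pi)) *
        ∑ j, |(Matrix.IsHermitian.eigenvalues
          (show C.IsHermitian from (C.conjTranspose_eq_transpose_of_trivial).trans hC)) j| := by
  exact mu_expCD_of_rotation _ (mulVec_rotation_eigenvectorBasis _)

end
end

section
/- Let n ≥ 1 and let a be a Schwartz function on ℝ²ⁿ. Then for every Schwartz function u on ℝⁿ, the Weyl quantization (Op^w(a) u)(x) = ∬_{ℝⁿ×ℝⁿ} e^{2πi(x−y)·ξ} a((x+y)/2, ξ) u(y) dy dξ satisfies ‖Op^w(a) u‖_{L²(ℝⁿ)} ≤ min(2ⁿ ‖a‖_{L¹(ℝ²ⁿ)}, ‖â‖_{L¹(ℝ²ⁿ)}) · ‖u‖_{L²(ℝⁿ)}, where â is the Fourier transform of a on ℝ²ⁿ. -/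
open MeasureTheory Matrix

noncomputable section

/-- The Weyl quantization
`(Op^w(a)u)(x) = ∬ e^{2πi(x−y)·ξ} a((x+y)/2, ξ) u(y) dy dξ`. -/
def weylOp {n : ℕ} (a : (Fin n → ℝ) × (Fin n → ℝ) → ℂ) (u : (Fin n → ℝ) → ℂ) :
    (Fin n → ℝ) → ℂ :=
  fun x => ∫ p : (Fin n → ℝ) × (Fin n → ℝ),
    Complex.exp (2 * (Real.pi : ℂ) * Complex.I * (((x - p.1) ⬝ᵥ p.2 : ℝ) : ℂ)) *
      a ((x + p.1) / 2, p.2) * u p.1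

/-- The Fourier transform on `ℝ²ⁿ`. -/
def ft2 {n : ℕ} (a : (Fin n → ℝ) × (Fin n → ℝ) → ℂ) :
    (Fin n → ℝ) × (Fin n → ℝ) → ℂ :=
  fun Ξ => ∫ X : (Fin n → ℝ) × (Fin n → ℝ),
    Complex.exp (-(2 * (Real.pi : ℂ) * Complex.I) *
      ((X.1 ⬝ᵥ Ξ.1 + X.2 ⬝ᵥ Ξ.2 : ℝ) : ℂ)) * a X

/-- Cauchy–Schwarz for the weighted measure `A μ`. -/
theorem sq_lintegral_mul_le {T : Type*} [MeasurableSpace T] {μ : Measure T} {A G : T → ENNReal}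
    (hA : AEMeasurable A μ) (hG : AEMeasurable G μ) :
    (∫⁻ t, A t * G t ∂μ) ^ 2 ≤ (∫⁻ t, A t ∂μ) * ∫⁻ t, A t * G t ^ 2 ∂μ := by
  have hsq (b : ENNReal) : (b ^ (1 / 2 : ℝ)) ^ 2 = b := by
    rw [← ENNReal.rpow_natCast, ← ENNReal.rpow_mul]; norm_num
  have h := ENNReal.lintegral_mul_le_Lp_mul_Lq μ Real.HolderConjugate.two_two
    (hA.pow_const (1 / 2 : ℝ)) ((hA.pow_const (1 / 2 : ℝ)).mul hG)
  simp only [Pi.mul_apply, ENNReal.rpow_two, mul_pow, hsq, ← mul_assoc, ← sq] at h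
  calc _ ≤ _ := pow_le_pow_left' h 2
    _ = _ := by rw [mul_pow, hsq, hsq]

/-- An `L²` Schur-type bound for a superposition of functions with controlled `L²` norm. -/
theorem lintegral_enorm_sq_le_of_superposition {E T : Type*} [MeasurableSpace E]
    [MeasurableSpace T] {μ : Measure E} {ν : Measure T} [SFinite μ] [SFinite ν]
    {F : E → ℂ} {A : T → ENNReal} {U : E → T → ENNReal} {c M : ENNReal}
    (hA : Measurable A) (hU : Measurable (Function.uncurry U))
    (hM : ∀ t, ∫⁻ x, U x t ^ 2 ∂μ ≤ M)
    (hF : ∀ x, ‖F x‖ₑ ≤ c * ∫⁻ t, A t * U x t ∂ν) :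
    ∫⁻ x, ‖F x‖ₑ ^ 2 ∂μ ≤ (c * ∫⁻ t, A t ∂ν) ^ 2 * M := by
  have hAU : Measurable (Function.uncurry fun x t => A t * U x t ^ 2) :=
    (hA.comp measurable_snd).mul (hU.pow_const 2)
  calc ∫⁻ x, ‖F x‖ₑ ^ 2 ∂μ
      ≤ ∫⁻ x, (c ^ 2 * ∫⁻ t, A t ∂ν) * ∫⁻ t, A t * U x t ^ 2 ∂ν ∂μ := by
        refine lintegral_mono fun x => (pow_le_pow_left' (hF x) 2).trans ?_
        rw [mul_pow, mul_assoc]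
        gcongr
        exact sq_lintegral_mul_le hA.aemeasurable
          (hU.comp measurable_prodMk_left).aemeasurable
    _ = (c ^ 2 * ∫⁻ t, A t ∂ν) * ∫⁻ t, ∫⁻ x, A t * U x t ^ 2 ∂μ ∂ν := by
        rw [lintegral_const_mul _ (by exact hAU.lintegral_prod_right'),
          lintegral_lintegral_swap hAU.aemeasurable]
    _ ≤ (c ^ 2 * ∫⁻ t, A t ∂ν) * ∫⁻ t, A t * M ∂ν := by
        gcongr with t
        rw [lintegral_const_mul _ (by exact (hU.comp measurable_prodMk_right).pow_const 2)]
        gcongr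
        exact hM t
    _ = (c * ∫⁻ t, A t ∂ν) ^ 2 * M := by
        rw [lintegral_mul_const _ hA]; ring

theorem sqrt_integral_sq_le_of_lintegral_le {E : Type*} [MeasurableSpace E] {μ : Measure E}
    {F u : E → ℂ} {C : ℝ} (hC : 0 ≤ C) (hu : MemLp u 2 μ)
    (h : ∫⁻ x, ‖F x‖ₑ ^ 2 ∂μ ≤ ENNReal.ofReal C ^ 2 * ∫⁻ x, ‖u x‖ₑ ^ 2 ∂μ) :
    Real.sqrt (∫ x, ‖F x‖ ^ 2 ∂μ) ≤ C * Real.sqrt (∫ x, ‖u x‖ ^ 2 ∂μ) := by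
  have hsq (f : E → ℂ) (x : E) : ENNReal.ofReal (‖f x‖ ^ 2) = ‖f x‖ₑ ^ 2 := by
    rw [ENNReal.ofReal_pow (norm_nonneg _), ofReal_norm]
  have hu2 : Integrable (fun x => ‖u x‖ ^ 2) μ := hu.integrable_norm_pow two_ne_zero
  have hu' : ENNReal.ofReal (∫ x, ‖u x‖ ^ 2 ∂μ) = ∫⁻ x, ‖u x‖ₑ ^ 2 ∂μ := by
    rw [ofReal_integral_eq_lintegral_ofReal hu2 (.of_forall fun x => by positivity)]
    simp only [hsq]
  by_cases hF : Integrable (fun x => ‖F x‖ ^ 2) μ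
  · have hF' : ENNReal.ofReal (∫ x, ‖F x‖ ^ 2 ∂μ) = ∫⁻ x, ‖F x‖ₑ ^ 2 ∂μ := by
      rw [ofReal_integral_eq_lintegral_ofReal hF (.of_forall fun x => by positivity)]
      simp only [hsq]
    rw [← hF', ← hu', ← ENNReal.ofReal_pow hC, ← ENNReal.ofReal_mul (by positivity),
      ENNReal.ofReal_le_ofReal_iff (by positivity)] at h
    calc _ ≤ Real.sqrt (C ^ 2 * ∫ x, ‖u x‖ ^ 2 ∂μ) := Real.sqrt_le_sqrt h
      _ = _ := by rw [Real.sqrt_mul (by positivity), Real.sqrt_sq hC]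
  · rw [integral_undef hF, Real.sqrt_zero]
    positivity

theorem enorm_le_lintegral_enorm_fourier {V : Type*} [NormedAddCommGroup V]
    [InnerProductSpace ℝ V] [MeasurableSpace V] [BorelSpace V] [FiniteDimensional ℝ V]
    {f : V → ℂ} (hc : Continuous f) (hf : Integrable f)
    (hf' : Integrable (FourierTransform.fourier f)) (v : V) :
    ‖f v‖ₑ ≤ ∫⁻ w, ‖FourierTransform.fourier f w‖ₑ := by
  conv_lhs => rw [← hf.fourierInv_fourier_eq hf' hc.continuousAt, Real.fourierInv_eq']
  refine (enorm_integral_le_lintegral_enorm _).trans (lintegral_mono fun w => ?_)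
  rw [enorm_smul, ← ofReal_norm, Complex.norm_exp_ofReal_mul_I]
  simp

/-- The identification of the Euclidean space `ℝ²ⁿ` with `ℝⁿ × ℝⁿ`. -/
def euclideanSumEquivProd (n : ℕ) :
    EuclideanSpace ℝ (Fin n ⊕ Fin n) ≃L[ℝ] (Fin n → ℝ) × (Fin n → ℝ) :=
  (EuclideanSpace.equiv (Fin n ⊕ Fin n) ℝ).trans
    (LinearEquiv.sumArrowLequivProdArrow (Fin n) (Fin n) ℝ ℝ).toContinuousLinearEquiv

theorem euclideanSumEquivProd_apply {n : ℕ} (v : EuclideanSpace ℝ (Fin n ⊕ Fin n)) :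
    euclideanSumEquivProd n v = (fun i => v (Sum.inl i), fun i => v (Sum.inr i)) := rfl

theorem measurePreserving_euclideanSumEquivProd (n : ℕ) :
    MeasurePreserving (euclideanSumEquivProd n) :=
  (volume_measurePreserving_sumPiEquivProdPi (fun _ : Fin n ⊕ Fin n => ℝ)).comp
    (PiLp.volume_preserving_ofLp (Fin n ⊕ Fin n))

theorem ft2_euclideanSumEquivProd {n : ℕ} (a : (Fin n → ℝ) × (Fin n → ℝ) → ℂ)
    (w : EuclideanSpace ℝ (Fin n ⊕ Fin n)) :
    ft2 a (euclideanSumEquivProd n w) =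
      FourierTransform.fourier (a ∘ euclideanSumEquivProd n) w := by
  rw [Real.fourier_eq', ft2, ← (measurePreserving_euclideanSumEquivProd n).integral_comp
    (euclideanSumEquivProd n).toHomeomorph.measurableEmbedding]
  refine integral_congr_ae (.of_forall fun v => ?_)
  simp only [euclideanSumEquivProd_apply, dotProduct, PiLp.inner_apply, Fintype.sum_sum_type,
    smul_eq_mul, Function.comp_apply, RCLike.inner_apply, conj_trivial]
  congr 2
  push_cast
  simp only [mul_comm]
  ring

instance isAddHaarMeasure_volume_prod {n : ℕ} :
    (volume : Measure ((Fin n → ℝ) × (Fin n → ℝ))).IsAddHaarMeasure :=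
  Measure.prod.instIsAddHaarMeasure (volume : Measure (Fin n → ℝ)) (volume : Measure (Fin n → ℝ))

theorem exists_schwartzMap_eq_ft2 {n : ℕ}
    (a : SchwartzMap ((Fin n → ℝ) × (Fin n → ℝ)) ℂ) :
    ∃ b : SchwartzMap ((Fin n → ℝ) × (Fin n → ℝ)) ℂ, ⇑b = ft2 a := by
  refine ⟨SchwartzMap.compCLMOfContinuousLinearEquiv ℂ (euclideanSumEquivProd n).symm
    (FourierTransform.fourier (SchwartzMap.compCLMOfContinuousLinearEquiv ℂ
      (euclideanSumEquivProd n) a)), ?_⟩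
  ext X
  conv_rhs => rw [← (euclideanSumEquivProd n).apply_symm_apply X, ft2_euclideanSumEquivProd]
  rfl

/-- A Schwartz function on a product is dominated, uniformly in the first variable, by an
integrable function of the second. -/
theorem SchwartzMap.exists_integrable_bound_snd {E F : Type*} [NormedAddCommGroup E]
    [NormedSpace ℝ E] [NormedAddCommGroup F] [NormedSpace ℝ F] [FiniteDimensional ℝ F]
    [MeasurableSpace F] [BorelSpace F] {μ : Measure F} [μ.IsAddHaarMeasure]
    (a : SchwartzMap (E × F) ℂ) :
    ∃ B : F → ℝ, Integrable B μ ∧ ∀ z ξ, ‖a (z, ξ)‖ ≤ B ξ := by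
  set k := Module.finrank ℝ F + 1
  refine ⟨fun ξ => (2 ^ k * ((Finset.Iic (k, 0)).sup
    fun m => SchwartzMap.seminorm ℝ m.1 m.2) a) * (1 + ‖ξ‖) ^ (-(k : ℝ)),
    (integrable_one_add_norm (by simp [k])).const_mul _, fun z ξ => ?_⟩
  have h := SchwartzMap.one_add_le_sup_seminorm_apply (𝕜 := ℝ) (m := (k, 0)) le_rfl le_rfl a (z, ξ)
  rw [norm_iteratedFDeriv_zero] at h
  simp only
  rw [Real.rpow_neg (by positivity), Real.rpow_natCast, ← div_eq_mul_inv,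
    le_div_iff₀ (by positivity), mul_comm]
  refine le_trans ?_ h
  gcongr
  exact norm_snd_le (z, ξ)

/-- The partial Fourier transform in the second variable. -/
def fourierSnd {n : ℕ} (a : (Fin n → ℝ) × (Fin n → ℝ) → ℂ) (z q : Fin n → ℝ) : ℂ :=
  ∫ ξ : Fin n → ℝ, Complex.exp (-(2 * (Real.pi : ℂ) * Complex.I) * ((ξ ⬝ᵥ q : ℝ) : ℂ)) * a (z, ξ)

theorem norm_exp_two_pi_I_mul (r : ℝ) :
    ‖Complex.exp (2 * (Real.pi : ℂ) * Complex.I * (r : ℂ))‖ = 1 := by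
  rw [← Complex.norm_exp_ofReal_mul_I (2 * Real.pi * r)]
  push_cast
  ring_nf

theorem norm_exp_neg_two_pi_I_mul (r : ℝ) :
    ‖Complex.exp (-(2 * (Real.pi : ℂ) * Complex.I) * (r : ℂ))‖ = 1 := by
  rw [← norm_exp_two_pi_I_mul (-r)]
  push_cast
  ring_nf

theorem continuous_fourierSnd {n : ℕ} (a : SchwartzMap ((Fin n → ℝ) × (Fin n → ℝ)) ℂ)
    (q : Fin n → ℝ) : Continuous fun z => fourierSnd a z q := by
  obtain ⟨B, hB, haB⟩ := a.exists_integrable_bound_snd (μ := volume)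
  have ha := a.continuous
  refine continuous_of_dominated (bound := B) (fun z => ?_) (fun z => .of_forall fun ξ => ?_) hB
    (.of_forall fun ξ => ?_)
  · exact Continuous.aestronglyMeasurable (by fun_prop)
  · rw [norm_mul, norm_exp_neg_two_pi_I_mul, one_mul]
    exact haB z ξ
  · fun_prop

theorem integrable_exp_mul_schwartz {n : ℕ} (a : SchwartzMap ((Fin n → ℝ) × (Fin n → ℝ)) ℂ)
    (φ : (Fin n → ℝ) × (Fin n → ℝ) → ℝ) (hφ : Continuous φ) :
    Integrable fun X => Complex.exp (-(2 * (Real.pi : ℂ) * Complex.I) * (φ X : ℂ)) * a X := by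
  refine a.integrable.bdd_mul (c := 1) (Continuous.aestronglyMeasurable (by fun_prop))
    (.of_forall fun X => (norm_exp_neg_two_pi_I_mul _).le)

theorem integrable_fourierSnd {n : ℕ} (a : SchwartzMap ((Fin n → ℝ) × (Fin n → ℝ)) ℂ)
    (q : Fin n → ℝ) : Integrable fun z => fourierSnd a z q :=
  (integrable_exp_mul_schwartz a (fun X => X.2 ⬝ᵥ q) (by fun_prop)).integral_prod_left

theorem ft2_eq_integral_fourierSnd {n : ℕ} (a : SchwartzMap ((Fin n → ℝ) × (Fin n → ℝ)) ℂ)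
    (p q : Fin n → ℝ) :
    ft2 a (p, q) = ∫ z : Fin n → ℝ,
      Complex.exp (-(2 * (Real.pi : ℂ) * Complex.I) * ((z ⬝ᵥ p : ℝ) : ℂ)) * fourierSnd a z q := by
  rw [ft2, Measure.volume_eq_prod, integral_prod _
    (integrable_exp_mul_schwartz a (fun X => X.1 ⬝ᵥ p + X.2 ⬝ᵥ q) (by fun_prop))]
  refine integral_congr_ae (.of_forall fun z => ?_)
  simp only [fourierSnd]
  rw [← integral_const_mul]
  refine integral_congr_ae (.of_forall fun ξ => ?_)
  simp only
  rw [← mul_assoc, ← Complex.exp_add]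
  push_cast
  ring_nf

theorem fourier_fourierSnd {n : ℕ} (a : SchwartzMap ((Fin n → ℝ) × (Fin n → ℝ)) ℂ)
    (q : Fin n → ℝ) (w : EuclideanSpace ℝ (Fin n)) :
    FourierTransform.fourier (fun v : EuclideanSpace ℝ (Fin n) => fourierSnd a v.ofLp q) w =
      ft2 a (w.ofLp, q) := by
  rw [Real.fourier_eq', ft2_eq_integral_fourierSnd,
    ← (PiLp.volume_preserving_ofLp (Fin n)).integral_comp
      (EuclideanSpace.equiv (Fin n) ℝ).toHomeomorph.measurableEmbedding]
  refine integral_congr_ae (.of_forall fun v => ?_)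
  simp only [dotProduct, PiLp.inner_apply, smul_eq_mul, RCLike.inner_apply, conj_trivial]
  congr 2
  push_cast
  simp only [mul_comm]
  ring

theorem ae_enorm_fourierSnd_le {n : ℕ} (a : SchwartzMap ((Fin n → ℝ) × (Fin n → ℝ)) ℂ) :
    ∀ᵐ q : Fin n → ℝ, ∀ z, ‖fourierSnd a z q‖ₑ ≤ ∫⁻ p : Fin n → ℝ, ‖ft2 a (p, q)‖ₑ := by
  obtain ⟨b, hb⟩ := exists_schwartzMap_eq_ft2 a
  have hint : Integrable (ft2 a) (volume.prod volume) := hb ▸ b.integrable (μ := volume)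
  have hmp := PiLp.volume_preserving_ofLp (Fin n)
  have hemb : MeasurableEmbedding (WithLp.ofLp : EuclideanSpace ℝ (Fin n) → Fin n → ℝ) :=
    (EuclideanSpace.equiv (Fin n) ℝ).toHomeomorph.measurableEmbedding
  filter_upwards [hint.prod_left_ae] with q hq z
  have hfour := funext (fourier_fourierSnd a q)
  have h := enorm_le_lintegral_enorm_fourier
    (f := fun v : EuclideanSpace ℝ (Fin n) => fourierSnd a v.ofLp q)
    ((continuous_fourierSnd a q).comp (PiLp.continuous_ofLp 2 _))
    ((hmp.integrable_comp_emb hemb).2 (integrable_fourierSnd a q))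
    (by rw [hfour]; exact (hmp.integrable_comp_emb hemb).2 hq) (WithLp.toLp 2 z)
  rw [hfour] at h
  exact h.trans_eq (hmp.lintegral_comp_emb hemb fun p => ‖ft2 a (p, q)‖ₑ)

theorem integrable_weylOp_integrand {n : ℕ} (a : SchwartzMap ((Fin n → ℝ) × (Fin n → ℝ)) ℂ)
    (u : SchwartzMap (Fin n → ℝ) ℂ) (x : Fin n → ℝ) :
    Integrable fun p : (Fin n → ℝ) × (Fin n → ℝ) =>
      Complex.exp (2 * (Real.pi : ℂ) * Complex.I * (((x - p.1) ⬝ᵥ p.2 : ℝ) : ℂ)) *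
        a ((x + p.1) / 2, p.2) * u p.1 := by
  obtain ⟨B, hB, haB⟩ := a.exists_integrable_bound_snd (μ := volume)
  have ha := a.continuous
  have hu := u.continuous
  refine (u.integrable.norm.mul_prod hB).mono'
    (Continuous.aestronglyMeasurable ?_) (.of_forall fun p => ?_)
  · have : Continuous fun p : (Fin n → ℝ) × (Fin n → ℝ) => (x + p.1) / 2 :=
      continuous_pi fun i => by
        simp only [Pi.div_apply, Pi.add_apply, Pi.ofNat_apply]
        fun_prop
    fun_prop
  · rw [norm_mul, norm_mul, norm_exp_two_pi_I_mul, one_mul, mul_comm]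
    gcongr
    exact haB _ _

theorem weylOp_eq_integral_fourierSnd {n : ℕ} (a : SchwartzMap ((Fin n → ℝ) × (Fin n → ℝ)) ℂ)
    (u : SchwartzMap (Fin n → ℝ) ℂ) (x : Fin n → ℝ) :
    weylOp a u x = ∫ y : Fin n → ℝ, fourierSnd a ((x + y) / 2) (y - x) * u y := by
  rw [weylOp, Measure.volume_eq_prod, integral_prod _ (integrable_weylOp_integrand a u x)]
  refine integral_congr_ae (.of_forall fun y => ?_)
  simp only [fourierSnd]
  rw [← integral_mul_const]
  refine integral_congr_ae (.of_forall fun ξ => ?_)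
  simp only
  rw [← neg_sub y x, neg_dotProduct, dotProduct_comm]
  push_cast
  ring_nf

theorem enorm_weylOp_le_lintegral_ft2 {n : ℕ} (a : SchwartzMap ((Fin n → ℝ) × (Fin n → ℝ)) ℂ)
    (u : SchwartzMap (Fin n → ℝ) ℂ) (x : Fin n → ℝ) :
    ‖weylOp a u x‖ₑ ≤
      ∫⁻ X : (Fin n → ℝ) × (Fin n → ℝ), ‖ft2 a X‖ₑ * ‖u (x + X.2)‖ₑ := by
  obtain ⟨b, hb⟩ := exists_schwartzMap_eq_ft2 a
  have hbm : Measurable fun X => ‖ft2 a X‖ₑ := hb ▸ b.continuous.enorm.measurable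
  have hum : Measurable fun X : (Fin n → ℝ) × (Fin n → ℝ) => ‖u (x + X.2)‖ₑ :=
    (u.continuous.comp (by fun_prop)).enorm.measurable
  have hae : ∀ᵐ y : Fin n → ℝ, ∀ z,
      ‖fourierSnd a z (y - x)‖ₑ ≤ ∫⁻ p : Fin n → ℝ, ‖ft2 a (p, y - x)‖ₑ :=
    (measurePreserving_sub_right volume x).quasiMeasurePreserving.ae (ae_enorm_fourierSnd_le a)
  rw [weylOp_eq_integral_fourierSnd]
  calc _ ≤ ∫⁻ y, ‖fourierSnd a ((x + y) / 2) (y - x) * u y‖ₑ :=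
        enorm_integral_le_lintegral_enorm _
    _ ≤ ∫⁻ y, (∫⁻ p : Fin n → ℝ, ‖ft2 a (p, y - x)‖ₑ) * ‖u y‖ₑ := by
        refine lintegral_mono_ae ?_
        filter_upwards [hae] with y hy
        rw [enorm_mul]
        gcongr
        exact hy _
    _ = ∫⁻ q, (∫⁻ p : Fin n → ℝ, ‖ft2 a (p, q)‖ₑ) * ‖u (x + q)‖ₑ := by
        rw [← lintegral_sub_right_eq_self
          (fun q => (∫⁻ p : Fin n → ℝ, ‖ft2 a (p, q)‖ₑ) * ‖u (x + q)‖ₑ) x]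
        simp
    _ = _ := by
        rw [Measure.volume_eq_prod, lintegral_prod_symm _ (by exact (hbm.mul hum).aemeasurable)]
        refine lintegral_congr fun q => ?_
        exact (lintegral_mul_const _ (hbm.comp measurable_prodMk_right)).symm

theorem lintegral_comp_midpoint {n : ℕ} {h : (Fin n → ℝ) → ENNReal} (hh : Measurable h)
    (x : Fin n → ℝ) : ∫⁻ y, h ((x + y) / 2) = 2 ^ n * ∫⁻ z, h z := by
  have hmid (y : Fin n → ℝ) : y / 2 = (2⁻¹ : ℝ) • y := by
    ext i; simp [div_eq_inv_mul]
  have hn : (2 : ENNReal) ^ n = ENNReal.ofReal |(((2⁻¹ : ℝ)) ^ Module.finrank ℝ (Fin n → ℝ))⁻¹| := by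
    simp [abs_of_nonneg, ENNReal.ofReal_pow]
  rw [lintegral_add_left_eq_self (fun y => h (y / 2)) x]
  simp only [hmid]
  rw [← lintegral_map hh (measurable_const_smul (2⁻¹ : ℝ)),
    Measure.map_addHaar_smul _ (by norm_num), lintegral_smul_measure, hn, smul_eq_mul]

theorem enorm_weylOp_le_lintegral {n : ℕ} (a : SchwartzMap ((Fin n → ℝ) × (Fin n → ℝ)) ℂ)
    (u : SchwartzMap (Fin n → ℝ) ℂ) (x : Fin n → ℝ) :
    ‖weylOp a u x‖ₑ ≤
      2 ^ n * ∫⁻ X : (Fin n → ℝ) × (Fin n → ℝ), ‖a X‖ₑ * ‖u ((2 : ℝ) • X.1 - x)‖ₑ := by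
  have ham : Measurable fun X => ‖a X‖ₑ := a.continuous.enorm.measurable
  have hum : Measurable fun z : Fin n → ℝ => ‖u ((2 : ℝ) • z - x)‖ₑ :=
    (u.continuous.comp (by fun_prop)).enorm.measurable
  have hmeas : Measurable fun X : (Fin n → ℝ) × (Fin n → ℝ) =>
    ‖a X‖ₑ * ‖u ((2 : ℝ) • X.1 - x)‖ₑ := ham.mul (hum.comp measurable_fst)
  have hmid (y : Fin n → ℝ) : (2 : ℝ) • ((x + y) / 2) - x = y := by
    ext i; simp; ring
  have hmidc : Measurable fun y : Fin n → ℝ => (x + y) / 2 := by fun_prop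
  calc _ ≤ ∫⁻ p : (Fin n → ℝ) × (Fin n → ℝ), ‖a ((x + p.1) / 2, p.2)‖ₑ * ‖u p.1‖ₑ := by
        refine (enorm_integral_le_lintegral_enorm _).trans_eq (lintegral_congr fun p => ?_)
        rw [enorm_mul, enorm_mul, ← ofReal_norm (Complex.exp _), norm_exp_two_pi_I_mul]
        simp
    _ = ∫⁻ y : Fin n → ℝ, ∫⁻ ξ : Fin n → ℝ,
          ‖a ((x + y) / 2, ξ)‖ₑ * ‖u ((2 : ℝ) • ((x + y) / 2) - x)‖ₑ := by
        simp only [hmid]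
        rw [Measure.volume_eq_prod, lintegral_prod]
        exact ((ham.comp ((hmidc.comp measurable_fst).prodMk measurable_snd)).mul
          (u.continuous.enorm.measurable.comp measurable_fst)).aemeasurable
    _ = _ := by
        rw [lintegral_comp_midpoint (h := fun z => ∫⁻ ξ : Fin n → ℝ,
          ‖a (z, ξ)‖ₑ * ‖u ((2 : ℝ) • z - x)‖ₑ) hmeas.lintegral_prod_right',
          Measure.volume_eq_prod, lintegral_prod _ hmeas.aemeasurable]

/-- `L²`-boundedness of the Weyl quantization:
`‖Op^w(a)u‖_{L²} ≤ min(2ⁿ‖a‖_{L¹}, ‖â‖_{L¹})·‖u‖_{L²}`. -/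
theorem weylOp_l2_bound {n : ℕ} (hn : 1 ≤ n)
    (a : SchwartzMap ((Fin n → ℝ) × (Fin n → ℝ)) ℂ)
    (u : SchwartzMap (Fin n → ℝ) ℂ) :
    Real.sqrt (∫ x, ‖weylOp (⇑a) (⇑u) x‖ ^ 2) ≤
      min ((2 : ℝ) ^ n * ∫ X, ‖a X‖) (∫ Ξ, ‖ft2 (⇑a) Ξ‖) *
        Real.sqrt (∫ x, ‖u x‖ ^ 2) := by
  have hu : MemLp u 2 volume := u.memLp 2 volume
  have hum : Measurable fun y => ‖u y‖ₑ := u.continuous.enorm.measurable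
  obtain ⟨b, hb⟩ := exists_schwartzMap_eq_ft2 a
  have hL1 (f : SchwartzMap ((Fin n → ℝ) × (Fin n → ℝ)) ℂ) :
      ENNReal.ofReal (∫ X, ‖f X‖) = ∫⁻ X, ‖f X‖ₑ :=
    ofReal_integral_norm_eq_lintegral_enorm f.integrable
  rw [min_mul_of_nonneg _ _ (Real.sqrt_nonneg _)]
  refine le_min (sqrt_integral_sq_le_of_lintegral_le (by positivity) hu ?_)
    (sqrt_integral_sq_le_of_lintegral_le (by positivity) hu ?_)
  · rw [ENNReal.ofReal_mul (by positivity), hL1, ENNReal.ofReal_pow (by positivity),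
      ENNReal.ofReal_ofNat]
    refine lintegral_enorm_sq_le_of_superposition (ν := volume)
      (U := fun x X => ‖u ((2 : ℝ) • X.1 - x)‖ₑ) a.continuous.enorm.measurable
      (hum.comp (by fun_prop)) (fun X => ?_) (fun x => ?_)
    · exact (lintegral_sub_left_eq_self (fun y => ‖u y‖ₑ ^ 2) _).le
    · exact enorm_weylOp_le_lintegral a u x
  · rw [← hb, hL1 b, ← one_mul (∫⁻ X, ‖b X‖ₑ)]
    refine lintegral_enorm_sq_le_of_superposition (ν := volume)
      (U := fun x X => ‖u (x + X.2)‖ₑ) b.continuous.enorm.measurable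
      (hum.comp (by fun_prop)) (fun X => ?_) (fun x => ?_)
    · exact (lintegral_add_right_eq_self (fun y => ‖u y‖ₑ ^ 2) _).le
    · rw [one_mul, hb]
      exact enorm_weylOp_le_lintegral_ft2 a u x

end
end
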